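/- arXiv:2602.13848 — 3 statements merged into one kernel-verified Lean document; each statement's English description precedes it below -/
import Mathlib

section
/- Let X be a real-valued random variable with cumulative distribution function F satisfying E[F(X)] = 1/2. Let F̂ : ℝ → [0,1] and ε : [0,1] → [0,1] be measurable functions such that |F̂(x) − F(x)| ≤ ε(F̂(x)) for every x ∈ ℝ. Then for every η ∈ ℝ and every k ≥ 0, E[η·(F̂(X) − 1/2) − √(η² + k²)·ε(F̂(X))] ≤ 0; in particular, for every constant 𝒞 > 0 the bet b := 1 + 𝒞·(η·(F̂(X) − 1/2) − √(η² + k²)·ε(F̂(X))) satisfies E[b] ≤ 1. -/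
open MeasureTheory

/-- If `F` is the CDF of a real random variable `X` with `E[F(X)] = 1/2`,
`F̂` takes values in `[0,1]`, `ε` maps `[0,1]` into `[0,1]`, and
`|F̂(x) − F(x)| ≤ ε(F̂(x))` for every `x`, then for all `η` and `k ≥ 0` the expected betting
gain is nonpositive, and the bet `1 + 𝒞·(η·(F̂(X) − 1/2) − √(η² + k²)·ε(F̂(X)))` has
expectation at most `1` for every `𝒞 > 0`. -/
theorem stmt0 {Ω : Type*} [MeasurableSpace Ω] (μ : Measure Ω) [IsProbabilityMeasure μ]
    (X : Ω → ℝ) (hX : Measurable X)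
    (F : ℝ → ℝ) (hF : ∀ x : ℝ, F x = (μ {ω | X ω ≤ x}).toReal)
    (hEF : ∫ ω, F (X ω) ∂μ = 1 / 2)
    (Fhat : ℝ → ℝ) (hFhatMeas : Measurable Fhat)
    (hFhat01 : ∀ x : ℝ, Fhat x ∈ Set.Icc (0 : ℝ) 1)
    (eps : ℝ → ℝ) (hepsMeas : Measurable eps)
    (heps01 : ∀ p ∈ Set.Icc (0 : ℝ) 1, eps p ∈ Set.Icc (0 : ℝ) 1)
    (hband : ∀ x : ℝ, |Fhat x - F x| ≤ eps (Fhat x)) :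
    ∀ η k : ℝ, 0 ≤ k →
      (∫ ω, (η * (Fhat (X ω) - 1 / 2) - Real.sqrt (η ^ 2 + k ^ 2) * eps (Fhat (X ω))) ∂μ ≤ 0)
      ∧ ∀ C : ℝ, 0 < C →
          ∫ ω, (1 + C * (η * (Fhat (X ω) - 1 / 2)
              - Real.sqrt (η ^ 2 + k ^ 2) * eps (Fhat (X ω)))) ∂μ ≤ 1 := by
  intro η k _
  have hFint : Integrable (fun ω => F (X ω)) μ := by
    by_contra h
    rw [integral_undef h] at hEF
    norm_num at hEF
  have hFhatInt : Integrable (fun ω => Fhat (X ω)) μ := by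
    refine Integrable.of_bound (hFhatMeas.comp hX).aestronglyMeasurable 1
      (Filter.Eventually.of_forall fun ω => ?_)
    obtain ⟨h0, h1⟩ := hFhat01 (X ω)
    rwa [Real.norm_of_nonneg h0]
  have hepsInt : Integrable (fun ω => eps (Fhat (X ω))) μ := by
    refine Integrable.of_bound (hepsMeas.comp (hFhatMeas.comp hX)).aestronglyMeasurable 1
      (Filter.Eventually.of_forall fun ω => ?_)
    obtain ⟨h0, h1⟩ := heps01 _ (hFhat01 (X ω))
    rwa [Real.norm_of_nonneg h0]
  have hgainInt : Integrable (fun ω => η * (Fhat (X ω) - 1 / 2)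
      - Real.sqrt (η ^ 2 + k ^ 2) * eps (Fhat (X ω))) μ :=
    ((hFhatInt.sub (integrable_const _)).const_mul η).sub (hepsInt.const_mul _)
  have hle : ∀ x, η * (Fhat x - 1 / 2) - Real.sqrt (η ^ 2 + k ^ 2) * eps (Fhat x)
      ≤ η * (F x - 1 / 2) := by
    intro x
    have hη : |η| ≤ Real.sqrt (η ^ 2 + k ^ 2) :=
      Real.abs_le_sqrt (le_add_of_nonneg_right (sq_nonneg k))
    have hmul : η * (Fhat x - F x) ≤ Real.sqrt (η ^ 2 + k ^ 2) * eps (Fhat x) :=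
      calc η * (Fhat x - F x) ≤ |η * (Fhat x - F x)| := le_abs_self _
        _ = |η| * |Fhat x - F x| := abs_mul _ _
        _ ≤ Real.sqrt (η ^ 2 + k ^ 2) * eps (Fhat x) :=
          mul_le_mul hη (hband x) (abs_nonneg _) (Real.sqrt_nonneg _)
    linarith
  have hgain : ∫ ω, (η * (Fhat (X ω) - 1 / 2)
      - Real.sqrt (η ^ 2 + k ^ 2) * eps (Fhat (X ω))) ∂μ ≤ 0 :=
    calc _ ≤ ∫ ω, η * (F (X ω) - 1 / 2) ∂μ :=
          integral_mono hgainInt ((hFint.sub (integrable_const _)).const_mul η)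
            fun ω => hle (X ω)
      _ = 0 := by
          rw [integral_const_mul, integral_sub hFint (integrable_const _), hEF]
          simp
  refine ⟨hgain, fun C hC => ?_⟩
  rw [integral_add (integrable_const _) (hgainInt.const_mul C), integral_const_mul]
  simpa using mul_nonpos_of_nonneg_of_nonpos hC.le hgain
end

section
/- Let p̂ be a [0,1]-valued random variable and ε : [0,1] → [0,1] a measurable function. Set μ := E[p̂] − 1/2 and ε̄ := E[ε(p̂)]. If |μ| > ε̄ (equivalently, the effective signal strength Δ₀ := |μ| − ε̄ is positive), then there exists k₀ > 0 such that for every smoothing parameter k ∈ (0, k₀): the quantity Δ_k := |μ| − √(1+k²)·ε̄ is positive and sup_{η ∈ [−1/2, 1/2]} E[ln(1 + g_k(p̂, η))] > 0. -/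
open MeasureTheory ProbabilityTheory

noncomputable section

/-- `ε* := sup_{p ∈ [0,1]} ε(p)`. -/
def epsStar (eps : ℝ → ℝ) : ℝ := sSup (eps '' Set.Icc (0 : ℝ) 1)

/-- The scaling constant `𝒞 := 1/(1/2 + √(1+k²)·ε*)`. -/
def Ck (eps : ℝ → ℝ) (k : ℝ) : ℝ :=
  1 / (1 / 2 + Real.sqrt (1 + k ^ 2) * epsStar eps)

/-- The betting gain `g_k(p, η) := 𝒞·(η·(p − 1/2) − √(η² + k²)·ε(p))`. -/
def gk (eps : ℝ → ℝ) (k p η : ℝ) : ℝ :=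
  Ck eps k * (η * (p - 1 / 2) - Real.sqrt (η ^ 2 + k ^ 2) * eps p)

theorem sqrt_sq_add_sq_le_abs_add_abs (a b : ℝ) : Real.sqrt (a ^ 2 + b ^ 2) ≤ |a| + |b| := by
  apply Real.sqrt_le_iff.mpr
  refine ⟨by positivity, ?_⟩
  nlinarith [sq_abs a, sq_abs b, mul_nonneg (abs_nonneg a) (abs_nonneg b)]

theorem sub_two_mul_sq_le_log_one_add {x : ℝ} (hx : |x| ≤ 1 / 2) :
    x - 2 * x ^ 2 ≤ Real.log (1 + x) := by
  obtain ⟨h1, -⟩ := abs_le.mp hx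
  have hpos : 0 < 1 + x := by linarith
  refine le_trans ?_ (Real.one_sub_inv_le_log_of_pos hpos)
  rw [← sub_nonneg]
  have : 1 - (1 + x)⁻¹ - (x - 2 * x ^ 2) = x ^ 2 * (1 + 2 * x) / (1 + x) := by
    field_simp
    ring
  rw [this]
  have : 0 ≤ 1 + 2 * x := by linarith
  positivity

theorem log_le_abs (x : ℝ) : Real.log x ≤ |x| := by
  rw [← Real.log_abs]
  exact Real.log_le_self (abs_nonneg x)

theorem epsStar_mem_Icc {eps : ℝ → ℝ}
    (heps01 : ∀ q ∈ Set.Icc (0 : ℝ) 1, eps q ∈ Set.Icc (0 : ℝ) 1) :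
    epsStar eps ∈ Set.Icc (0 : ℝ) 1 := by
  constructor
  · apply Real.sSup_nonneg
    rintro _ ⟨q, hq, rfl⟩
    exact (heps01 q hq).1
  · apply Real.sSup_le _ zero_le_one
    rintro _ ⟨q, hq, rfl⟩
    exact (heps01 q hq).2

theorem Ck_mem_Ioc {eps : ℝ → ℝ}
    (heps01 : ∀ q ∈ Set.Icc (0 : ℝ) 1, eps q ∈ Set.Icc (0 : ℝ) 1) (k : ℝ) :
    Ck eps k ∈ Set.Ioc (0 : ℝ) 2 := by
  have h := (epsStar_mem_Icc heps01).1
  have h' : 0 ≤ Real.sqrt (1 + k ^ 2) * epsStar eps := mul_nonneg (Real.sqrt_nonneg _) h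
  refine ⟨by unfold Ck; positivity, ?_⟩
  unfold Ck
  rw [div_le_iff₀ (by positivity)]
  linarith

theorem two_fifths_le_Ck {eps : ℝ → ℝ}
    (heps01 : ∀ q ∈ Set.Icc (0 : ℝ) 1, eps q ∈ Set.Icc (0 : ℝ) 1) {k : ℝ} (hk : |k| ≤ 1) :
    2 / 5 ≤ Ck eps k := by
  obtain ⟨h0, h1⟩ := epsStar_mem_Icc heps01
  have hs : Real.sqrt (1 + k ^ 2) ≤ 2 := by
    have := sqrt_sq_add_sq_le_abs_add_abs 1 k
    rw [one_pow, abs_one] at this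
    linarith
  have h' : 0 ≤ Real.sqrt (1 + k ^ 2) * epsStar eps := mul_nonneg (Real.sqrt_nonneg _) h0
  have h'' : Real.sqrt (1 + k ^ 2) * epsStar eps ≤ 2 * 1 :=
    mul_le_mul hs h1 h0 (by norm_num)
  unfold Ck
  rw [le_div_iff₀ (by positivity)]
  linarith

theorem abs_gk_le {eps : ℝ → ℝ}
    (heps01 : ∀ q ∈ Set.Icc (0 : ℝ) 1, eps q ∈ Set.Icc (0 : ℝ) 1) (k η : ℝ) {p : ℝ}
    (hp : p ∈ Set.Icc (0 : ℝ) 1) : |gk eps k p η| ≤ 3 * |η| + 2 * |k| := by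
  obtain ⟨hC0, hC2⟩ := Ck_mem_Ioc heps01 k
  obtain ⟨he0, he1⟩ := heps01 p hp
  have hs := sqrt_sq_add_sq_le_abs_add_abs η k
  have hp' : |p - 1 / 2| ≤ 1 / 2 := by
    rw [abs_le]
    constructor <;> linarith [hp.1, hp.2]
  have h1 : |η * (p - 1 / 2)| ≤ |η| * (1 / 2) := by
    rw [abs_mul]
    gcongr
  have h2 : |Real.sqrt (η ^ 2 + k ^ 2) * eps p| ≤ |η| + |k| := by
    rw [abs_of_nonneg (mul_nonneg (Real.sqrt_nonneg _) he0)]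
    exact (mul_le_of_le_one_right (Real.sqrt_nonneg _) he1).trans hs
  unfold gk
  rw [abs_mul, abs_of_pos hC0]
  calc _ ≤ 2 * (|η| * (1 / 2) + (|η| + |k|)) := by
        gcongr
        exact (abs_sub _ _).trans (add_le_add h1 h2)
    _ = _ := by ring

/-- Let `p̂` be a `[0,1]`-valued random variable and `ε : [0,1] → [0,1]`
measurable. With `μ := E[p̂] − 1/2` and `ε̄ := E[ε(p̂)]`, if `|μ| > ε̄` then there exists
`k₀ > 0` such that for every `k ∈ (0, k₀)`: `Δ_k := |μ| − √(1+k²)·ε̄ > 0` and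
`sup_{η ∈ [−1/2, 1/2]} E[ln(1 + g_k(p̂, η))] > 0`. -/
theorem stmt4 {Ω : Type*} [MeasurableSpace Ω] (μ : Measure Ω) [IsProbabilityMeasure μ]
    (phat : Ω → ℝ) (hpm : Measurable phat) (hp01 : ∀ ω, phat ω ∈ Set.Icc (0 : ℝ) 1)
    (eps : ℝ → ℝ) (hepsMeas : Measurable eps)
    (heps01 : ∀ q ∈ Set.Icc (0 : ℝ) 1, eps q ∈ Set.Icc (0 : ℝ) 1)
    (hsignal : ∫ ω, eps (phat ω) ∂μ < |(∫ ω, phat ω ∂μ) - 1 / 2|) :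
    ∃ k₀ > (0 : ℝ), ∀ k ∈ Set.Ioo (0 : ℝ) k₀,
      0 < |(∫ ω, phat ω ∂μ) - 1 / 2| - Real.sqrt (1 + k ^ 2) * ∫ ω, eps (phat ω) ∂μ
      ∧ 0 < sSup ((fun η => ∫ ω, Real.log (1 + gk eps k (phat ω) η) ∂μ) ''
          Set.Icc (-(1 / 2) : ℝ) (1 / 2)) := by
  set m := (∫ ω, phat ω ∂μ) - 1 / 2 with hm
  set e := ∫ ω, eps (phat ω) ∂μ with he
  have hbdd {f : Ω → ℝ} (hf : Measurable f) (h : ∀ ω, f ω ∈ Set.Icc (0 : ℝ) 1) :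
      Integrable f μ :=
    Integrable.of_bound hf.aestronglyMeasurable 1 (ae_of_all _ fun ω => by
      rw [Real.norm_eq_abs, abs_of_nonneg (h ω).1]
      exact (h ω).2)
  have hle {f : Ω → ℝ} (hf : Integrable f μ) {c : ℝ} (h : ∀ ω, f ω ≤ c) : ∫ ω, f ω ∂μ ≤ c := by
    simpa using integral_mono hf (integrable_const c) h
  have hpi : Integrable phat μ := hbdd hpm hp01
  have hei : Integrable (fun ω => eps (phat ω)) μ :=
    hbdd (hepsMeas.comp hpm) fun ω => heps01 _ (hp01 ω)
  have he0 : 0 ≤ e := integral_nonneg fun ω => (heps01 _ (hp01 ω)).1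
  have hm2 : |m| ≤ 1 / 2 := by
    have h0 : 0 ≤ ∫ ω, phat ω ∂μ := integral_nonneg fun ω => (hp01 ω).1
    have h1 : ∫ ω, phat ω ∂μ ≤ 1 := hle hpi fun ω => (hp01 ω).2
    rw [abs_le]
    constructor <;> linarith
  obtain ⟨D, hD⟩ : ∃ D, D = |m| - e := ⟨_, rfl⟩
  have hD0 : 0 < D := by linarith
  have hD2 : D ≤ 1 / 2 := by linarith
  obtain ⟨h, hh⟩ : ∃ h, h = D / 500 := ⟨_, rfl⟩
  have hh0 : 0 < h := by linarith
  refine ⟨h * D / 2, by positivity, ?_⟩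
  rintro k ⟨hk0, hk⟩
  have hkh : k ≤ h := by nlinarith
  have hkabs : |k| = k := abs_of_pos hk0
  constructor
  · have := sqrt_sq_add_sq_le_abs_add_abs 1 k
    rw [one_pow, abs_one, hkabs] at this
    nlinarith
  obtain ⟨η, hηabs, hηm⟩ : ∃ η : ℝ, |η| = h ∧ η * m = h * |m| := by
    rcases le_total 0 m with hm0 | hm0
    · exact ⟨h, abs_of_pos hh0, by rw [abs_of_nonneg hm0]⟩
    · exact ⟨-h, by rw [abs_neg, abs_of_pos hh0], by rw [abs_of_nonpos hm0]; ring⟩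
  have hg (ω : Ω) : |gk eps k (phat ω) η| ≤ 5 * h := by
    have := abs_gk_le heps01 k η (hp01 ω)
    rw [hηabs, hkabs] at this
    linarith
  have hpη : Integrable (fun ω => η * (phat ω - 1 / 2)) μ :=
    (hpi.sub (integrable_const (1 / 2))).const_mul η
  have hgi : Integrable (fun ω => gk eps k (phat ω) η) μ :=
    (hpη.sub (hei.const_mul (Real.sqrt (η ^ 2 + k ^ 2)))).const_mul (Ck eps k)
  have hgE : ∫ ω, gk eps k (phat ω) η ∂μ =
      Ck eps k * (η * m - Real.sqrt (η ^ 2 + k ^ 2) * e) := by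
    unfold gk
    rw [integral_const_mul, integral_sub hpη (hei.const_mul _), integral_const_mul,
      integral_const_mul, integral_sub hpi (integrable_const _)]
    simp [hm, he]
  have hgE' : h * D / 5 ≤ ∫ ω, gk eps k (phat ω) η ∂μ := by
    have hs := sqrt_sq_add_sq_le_abs_add_abs η k
    rw [hηabs, hkabs] at hs
    have hC := two_fifths_le_Ck heps01 (k := k) (by rw [hkabs]; linarith)
    have hlow : h * D / 2 ≤ η * m - Real.sqrt (η ^ 2 + k ^ 2) * e := by
      rw [hηm]
      have h1 : Real.sqrt (η ^ 2 + k ^ 2) * e ≤ (h + k) * e := by gcongr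
      have h2 : k * e ≤ k * 1 := by
        gcongr
        linarith
      have h3 : h * D = h * |m| - h * e := by rw [hD]; ring
      linarith
    rw [hgE]
    calc h * D / 5 = 2 / 5 * (h * D / 2) := by ring
      _ ≤ _ := mul_le_mul hC hlow (by positivity) (by linarith)
  have hlog (ω : Ω) : gk eps k (phat ω) η - 50 * h ^ 2 ≤ Real.log (1 + gk eps k (phat ω) η) := by
    refine le_trans ?_ (sub_two_mul_sq_le_log_one_add ((hg ω).trans (by linarith)))
    have := sq_le_sq' (abs_le.mp (hg ω)).1 (abs_le.mp (hg ω)).2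
    linarith
  have hlogi : Integrable (fun ω => Real.log (1 + gk eps k (phat ω) η)) μ := by
    refine Integrable.of_bound (C := 2) ?_ (ae_of_all _ fun ω => ?_)
    · have : Measurable (fun ω => eps (phat ω)) := hepsMeas.comp hpm
      unfold gk
      exact Measurable.aestronglyMeasurable (by fun_prop)
    · have h1 := hlog ω
      have h2 := log_le_abs (1 + gk eps k (phat ω) η)
      obtain ⟨h3, h4⟩ := abs_le.mp (hg ω)
      rw [abs_of_nonneg (by linarith)] at h2
      rw [Real.norm_eq_abs, abs_le]
      constructor <;> nlinarith
  have hpos : 0 < ∫ ω, Real.log (1 + gk eps k (phat ω) η) ∂μ := by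
    have h1 := integral_mono (hgi.sub (integrable_const (50 * h ^ 2))) hlogi hlog
    simp only [Pi.sub_apply] at h1
    rw [integral_sub hgi (integrable_const _)] at h1
    simp only [integral_const, probReal_univ, one_smul] at h1
    have h2 : h * D = 500 * h ^ 2 := by rw [hh]; ring
    have h3 : 0 < h ^ 2 := by positivity
    linarith
  refine lt_of_lt_of_le hpos (le_csSup ⟨5, ?_⟩ ⟨η, abs_le.mp (by linarith), rfl⟩)
  rintro _ ⟨x, hx, rfl⟩
  by_cases hi : Integrable (fun ω => Real.log (1 + gk eps k (phat ω) x)) μ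
  · refine hle hi fun ω => ?_
    have h1 := abs_gk_le heps01 k x (hp01 ω)
    have h2 := log_le_abs (1 + gk eps k (phat ω) x)
    have h3 := abs_add_le 1 (gk eps k (phat ω) x)
    have h4 : |x| ≤ 1 / 2 := abs_le.mpr hx
    rw [abs_one] at h3
    rw [hkabs] at h1
    linarith
  · simp only [integral_undef hi]
    norm_num

end
end

section
/- Let p̂₁, p̂₂, … ∈ [0,1] be an arbitrary sequence, ε : [0,1] → [0,1] a measurable function, and k > 0. Let (η_t) be the Online Newton Step iterates and define the per-round losses ℓ_t and regret R_T. Then for every T ≥ 1 and every benchmark η̃ ∈ [−1/2, 1/2], R_T(η̃) ≤ 2·ln(1 + 4T) + 1/2. -/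
open MeasureTheory

noncomputable section

/-- State of the Online Newton Step recursion: `onsState t = (η_{t+1}, a_t)`, with
`η₁ = 0` and `a₀ = 1`. -/
def onsState (eps : ℝ → ℝ) (k : ℝ) (p : ℕ → ℝ) : ℕ → ℝ × ℝ
  | 0 => (0, 1)
  | t + 1 =>
    let s := onsState eps k p t
    let η := s.1
    let a := s.2
    let g := gk eps k (p (t + 1)) η
    let g' := Ck eps k * (p (t + 1) - 1 / 2 - (η / Real.sqrt (η ^ 2 + k ^ 2)) * eps (p (t + 1)))
    let z := g' / (1 + g)
    let a' := a + z ^ 2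
    (min (1 / 2) (max (-(1 / 2)) (η + 4 * z / a')), a')

/-- The ONS iterate `η_t` (for `t ≥ 1`); it depends only on `p̂_1, …, p̂_{t-1}`. -/
def onsEta (eps : ℝ → ℝ) (k : ℝ) (p : ℕ → ℝ) (t : ℕ) : ℝ :=
  (onsState eps k p (t - 1)).1

/-- The per-round loss `ℓ_t(η) := −ln(1 + g_k(p̂_t, η))`. -/
def onsLoss (eps : ℝ → ℝ) (k : ℝ) (p : ℕ → ℝ) (t : ℕ) (η : ℝ) : ℝ :=
  -Real.log (1 + gk eps k (p t) η)

/-- The regret `R_T(η̃) := Σ_{t=1}^T ℓ_t(η_t) − Σ_{t=1}^T ℓ_t(η̃)` of a sequence `(η_t)`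
against the fixed benchmark `η̃`. -/
def regret (eps : ℝ → ℝ) (k : ℝ) (p η : ℕ → ℝ) (ηb : ℝ) (T : ℕ) : ℝ :=
  ∑ t ∈ Finset.Icc 1 T, (onsLoss eps k p t (η t) - onsLoss eps k p t ηb)

/-- The tangent-line bound for the convex function `x ↦ √(x² + k²)`. -/
lemma sqrt_sq_add_sq_tangent {k : ℝ} (hk : 0 < k) (x y : ℝ) :
    √(x ^ 2 + k ^ 2) + x / √(x ^ 2 + k ^ 2) * (y - x) ≤ √(y ^ 2 + k ^ 2) := by
  have hs : 0 < √(x ^ 2 + k ^ 2) := by positivity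
  have hs2 : √(x ^ 2 + k ^ 2) ^ 2 = x ^ 2 + k ^ 2 := Real.sq_sqrt (by positivity)
  have hmul : x * y + k ^ 2 ≤ √(x ^ 2 + k ^ 2) * √(y ^ 2 + k ^ 2) := by
    rw [← Real.sqrt_mul (by positivity)]
    apply Real.le_sqrt_of_sq_le
    nlinarith [sq_nonneg (k * (x - y))]
  have heq : √(x ^ 2 + k ^ 2) + x / √(x ^ 2 + k ^ 2) * (y - x)
      = (x * y + k ^ 2) / √(x ^ 2 + k ^ 2) := by
    field_simp
    rw [hs2]
    ring
  rw [heq, div_le_iff₀ hs]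
  linarith

lemma log_one_add_le_sub_sq {x : ℝ} (hx : -1 < x) (hx3 : x ≤ 3) :
    Real.log (1 + x) ≤ x - x ^ 2 / 8 := by
  let f : ℝ → ℝ := fun y => y - y ^ 2 / 8 - Real.log (1 + y)
  have hderiv : ∀ y : ℝ, -1 < y → HasDerivAt f (y * (3 - y) / (4 * (1 + y))) y := by
    intro y hy
    have hpos : 0 < 1 + y := by linarith
    have h := ((hasDerivAt_id y).sub (((hasDerivAt_id y).pow 2).div_const 8)).sub
      (((hasDerivAt_id y).const_add 1).log hpos.ne')
    refine HasDerivAt.congr_deriv (f := f) h ?_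
    simp only [id]
    field_simp
    ring
  have hf0 : f 0 = 0 := by simp [f]
  suffices 0 ≤ f x by simp only [f] at this; linarith
  rcases le_total 0 x with h0 | h0
  · have hmono : MonotoneOn f (Set.Icc 0 x) := by
      refine monotoneOn_of_hasDerivWithinAt_nonneg (convex_Icc 0 x)
        (fun y hy => (hderiv y (by linarith [hy.1])).continuousAt.continuousWithinAt)
        (f' := fun y => y * (3 - y) / (4 * (1 + y))) ?_ ?_
      all_goals
        intro y hy
        rw [interior_Icc] at hy
      · exact (hderiv y (by linarith [hy.1])).hasDerivWithinAt
      · exact div_nonneg (mul_nonneg hy.1.le (by linarith [hy.2])) (by linarith [hy.1])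
    simpa [hf0] using hmono (Set.left_mem_Icc.2 h0) (Set.right_mem_Icc.2 h0) h0
  · have hanti : AntitoneOn f (Set.Icc x 0) := by
      refine antitoneOn_of_hasDerivWithinAt_nonpos (convex_Icc x 0)
        (fun y hy => (hderiv y (by linarith [hy.1])).continuousAt.continuousWithinAt)
        (f' := fun y => y * (3 - y) / (4 * (1 + y))) ?_ ?_
      all_goals
        intro y hy
        rw [interior_Icc] at hy
      · exact (hderiv y (by linarith [hy.1])).hasDerivWithinAt
      · exact div_nonpos_of_nonpos_of_nonneg
          (mul_nonpos_of_nonpos_of_nonneg hy.2.le (by linarith [hy.2])) (by linarith [hy.1])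
    simpa [hf0] using hanti (Set.left_mem_Icc.2 h0) (Set.right_mem_Icc.2 h0) h0

/-- The derivative of the betting gain `gk eps k q` at `η`. -/
def gkDeriv (eps : ℝ → ℝ) (k q η : ℝ) : ℝ :=
  Ck eps k * (q - 1 / 2 - (η / √(η ^ 2 + k ^ 2)) * eps q)

/-- The normalised gradient `g' / (1 + g)` used by the Newton step. -/
def onsGrad (eps : ℝ → ℝ) (k q η : ℝ) : ℝ :=
  gkDeriv eps k q η / (1 + gk eps k q η)

section Gain

variable {eps : ℝ → ℝ} {k q : ℝ}

lemma le_epsStar (heps : ∀ q ∈ Set.Icc (0 : ℝ) 1, eps q ∈ Set.Icc (0 : ℝ) 1)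
    (hq : q ∈ Set.Icc (0 : ℝ) 1) : eps q ≤ epsStar eps :=
  le_csSup ⟨1, by rintro _ ⟨r, hr, rfl⟩; exact (heps r hr).2⟩ ⟨q, hq, rfl⟩

lemma epsStar_nonneg (heps : ∀ q ∈ Set.Icc (0 : ℝ) 1, eps q ∈ Set.Icc (0 : ℝ) 1) :
    0 ≤ epsStar eps :=
  have h0 : (0 : ℝ) ∈ Set.Icc (0 : ℝ) 1 := by simp
  (heps 0 h0).1.trans (le_epsStar heps h0)

lemma Ck_pos (heps : ∀ q ∈ Set.Icc (0 : ℝ) 1, eps q ∈ Set.Icc (0 : ℝ) 1) : 0 < Ck eps k := by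
  have := epsStar_nonneg heps
  unfold Ck
  positivity

lemma Ck_mul_le_one_add_gk (heps : ∀ q ∈ Set.Icc (0 : ℝ) 1, eps q ∈ Set.Icc (0 : ℝ) 1)
    (hq : q ∈ Set.Icc (0 : ℝ) 1) {η : ℝ} (hη : |η| ≤ 1) :
    Ck eps k * ((1 - |η|) / 2) ≤ 1 + gk eps k q η := by
  have hstar := epsStar_nonneg heps
  have hnorm : Ck eps k * (1 / 2 + √(1 + k ^ 2) * epsStar eps) = 1 := by
    unfold Ck
    exact one_div_mul_cancel (by positivity)
  have hsqrt : √(η ^ 2 + k ^ 2) * eps q ≤ √(1 + k ^ 2) * epsStar eps := by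
    have hη2 : η ^ 2 ≤ 1 := (sq_le_one_iff_abs_le_one η).2 hη
    exact mul_le_mul (Real.sqrt_le_sqrt (by linarith)) (le_epsStar heps hq) (heps q hq).1
      (Real.sqrt_nonneg _)
  have hlin : -(|η| / 2) ≤ η * (q - 1 / 2) := by
    have h : |η * (q - 1 / 2)| ≤ |η| * (1 / 2) := by
      rw [abs_mul]
      exact mul_le_mul_of_nonneg_left
        (abs_le.2 ⟨by linarith [hq.1], by linarith [hq.2]⟩) (abs_nonneg _)
    linarith [(abs_le.1 h).1]
  rw [← hnorm]
  unfold gk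
  rw [← mul_add]
  exact mul_le_mul_of_nonneg_left (by linarith) (Ck_pos heps).le

lemma one_add_gk_pos (heps : ∀ q ∈ Set.Icc (0 : ℝ) 1, eps q ∈ Set.Icc (0 : ℝ) 1)
    (hq : q ∈ Set.Icc (0 : ℝ) 1) {η : ℝ} (hη : |η| < 1) : 0 < 1 + gk eps k q η :=
  (mul_pos (Ck_pos heps) (by linarith)).trans_le (Ck_mul_le_one_add_gk heps hq hη.le)

/-- The betting gain is concave in `η`, so it lies below its tangent lines. -/
lemma one_add_gk_le_tangent (heps : ∀ q ∈ Set.Icc (0 : ℝ) 1, eps q ∈ Set.Icc (0 : ℝ) 1)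
    (hk : 0 < k) (hq : q ∈ Set.Icc (0 : ℝ) 1) {x : ℝ} (hx : |x| < 1) (y : ℝ) :
    1 + gk eps k q y ≤ (1 + gk eps k q x) * (1 + onsGrad eps k q x * (y - x)) := by
  have hpos := one_add_gk_pos (k := k) heps hq hx
  have heq : (1 + gk eps k q x) * (1 + onsGrad eps k q x * (y - x))
      = 1 + gk eps k q x + gkDeriv eps k q x * (y - x) := by
    unfold onsGrad
    field_simp
  rw [heq]
  have h := mul_le_mul_of_nonneg_left
    (mul_le_mul_of_nonneg_right (sqrt_sq_add_sq_tangent hk x y) (heps q hq).1)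
    (Ck_pos (k := k) heps).le
  unfold gk gkDeriv
  nlinarith [h]

lemma abs_onsGrad_le_two (heps : ∀ q ∈ Set.Icc (0 : ℝ) 1, eps q ∈ Set.Icc (0 : ℝ) 1)
    (hk : 0 < k) (hq : q ∈ Set.Icc (0 : ℝ) 1) {x : ℝ} (hx : |x| ≤ 1 / 2) :
    |onsGrad eps k q x| ≤ 2 := by
  have hx1 : |x| < 1 := by linarith
  have hpos := one_add_gk_pos (k := k) heps hq hx1
  have key : ∀ y : ℝ, |y| = 1 → 0 ≤ 1 + onsGrad eps k q x * (y - x) := by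
    intro y hy
    have h := Ck_mul_le_one_add_gk (k := k) heps hq hy.le
    rw [hy, sub_self, zero_div, mul_zero] at h
    exact nonneg_of_mul_nonneg_right (h.trans (one_add_gk_le_tangent heps hk hq hx1 y)) hpos
  have hright := key 1 (by simp)
  have hleft := key (-1) (by simp)
  obtain ⟨hlo, hhi⟩ := abs_le.1 hx
  exact abs_le.2 ⟨by nlinarith, by nlinarith⟩

lemma onsLoss_sub_le (heps : ∀ q ∈ Set.Icc (0 : ℝ) 1, eps q ∈ Set.Icc (0 : ℝ) 1)
    (hk : 0 < k) {p : ℕ → ℝ} (hp : ∀ t, p t ∈ Set.Icc (0 : ℝ) 1) (t : ℕ) {x y : ℝ}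
    (hx : |x| ≤ 1 / 2) (hy : |y| ≤ 1 / 2) :
    onsLoss eps k p t x - onsLoss eps k p t y ≤
      onsGrad eps k (p t) x * (y - x) - (onsGrad eps k (p t) x * (y - x)) ^ 2 / 8 := by
  have hx1 : |x| < 1 := by linarith
  have hposx := one_add_gk_pos (k := k) heps (hp t) hx1
  have hposy := one_add_gk_pos (k := k) heps (hp t) (show |y| < 1 by linarith)
  have htan := one_add_gk_le_tangent heps hk (hp t) hx1 y
  have hpos : 0 < 1 + onsGrad eps k (p t) x * (y - x) :=
    pos_of_mul_pos_right (hposy.trans_le htan) hposx.le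
  have hlog := Real.log_le_log hposy htan
  rw [Real.log_mul hposx.ne' hpos.ne'] at hlog
  have hle : onsGrad eps k (p t) x * (y - x) ≤ 2 := by
    have hyx : |y - x| ≤ 1 := (abs_sub y x).trans (by linarith)
    calc _ ≤ |onsGrad eps k (p t) x * (y - x)| := le_abs_self _
      _ = |onsGrad eps k (p t) x| * |y - x| := abs_mul _ _
      _ ≤ 2 * 1 := mul_le_mul (abs_onsGrad_le_two heps hk (hp t) hx) hyx (abs_nonneg _) (by simp)
      _ = 2 := mul_one 2
  have hquad := log_one_add_le_sub_sq (x := onsGrad eps k (p t) x * (y - x))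
    (by linarith) (by linarith)
  unfold onsLoss
  linarith

end Gain

/-- Projection onto `[-c, c]` does not increase the distance to a point of `[-c, c]`. -/
lemma sq_sub_clip_le {c x y : ℝ} (hy : |y| ≤ c) :
    (y - min c (max (-c) x)) ^ 2 ≤ (y - x) ^ 2 := by
  obtain ⟨h1, h2⟩ := abs_le.1 hy
  rcases max_cases (-c) x with ⟨ha, ha'⟩ | ⟨ha, ha'⟩ <;>
    rcases min_cases c (max (-c) x) with ⟨hb, hb'⟩ | ⟨hb, hb'⟩ <;>
    rw [hb] <;> rw [ha] at * <;> nlinarith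

lemma abs_clip_le {c x : ℝ} (hc : 0 ≤ c) : |min c (max (-c) x)| ≤ c :=
  abs_le.2 ⟨le_min (by linarith) (le_max_left _ _), min_le_left _ _⟩

/-- One-step potential inequality of the Online Newton Step. -/
lemma newton_step_le {a z x y : ℝ} (ha : 0 < a) (hy : |y| ≤ 1 / 2) :
    z * (y - x) - (z * (y - x)) ^ 2 / 8 ≤
      a * (y - x) ^ 2 / 8
      - (a + z ^ 2) * (y - min (1 / 2) (max (-(1 / 2)) (x + 4 * z / (a + z ^ 2)))) ^ 2 / 8
      + 2 * (Real.log (a + z ^ 2) - Real.log a) := by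
  have hb : 0 < a + z ^ 2 := by positivity
  have hproj := mul_le_mul_of_nonneg_left
    (sq_sub_clip_le (x := x + 4 * z / (a + z ^ 2)) hy) hb.le
  have hexp : (a + z ^ 2) * (y - (x + 4 * z / (a + z ^ 2))) ^ 2
      = (a + z ^ 2) * (y - x) ^ 2 - 8 * (z * (y - x)) + 16 * (z ^ 2 / (a + z ^ 2)) := by
    field_simp
    ring
  have hlog : z ^ 2 / (a + z ^ 2) ≤ Real.log (a + z ^ 2) - Real.log a := by
    have h := Real.log_le_sub_one_of_pos (div_pos ha hb)
    rw [Real.log_div ha.ne' hb.ne'] at h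
    have heq : z ^ 2 / (a + z ^ 2) = 1 - a / (a + z ^ 2) := by
      field_simp
      ring
    linarith
  nlinarith

lemma onsState_succ (eps : ℝ → ℝ) (k : ℝ) (p : ℕ → ℝ) (t : ℕ) :
    onsState eps k p (t + 1) =
      (min (1 / 2) (max (-(1 / 2)) ((onsState eps k p t).1
        + 4 * onsGrad eps k (p (t + 1)) (onsState eps k p t).1
          / ((onsState eps k p t).2 + onsGrad eps k (p (t + 1)) (onsState eps k p t).1 ^ 2))),
        (onsState eps k p t).2 + onsGrad eps k (p (t + 1)) (onsState eps k p t).1 ^ 2) :=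
  rfl

lemma abs_onsState_fst_le (eps : ℝ → ℝ) (k : ℝ) (p : ℕ → ℝ) (t : ℕ) :
    |(onsState eps k p t).1| ≤ 1 / 2 := by
  cases t with
  | zero => simp [onsState]
  | succ t => exact abs_clip_le (by norm_num)

lemma onsState_snd_pos (eps : ℝ → ℝ) (k : ℝ) (p : ℕ → ℝ) (t : ℕ) :
    0 < (onsState eps k p t).2 := by
  induction t with
  | zero => simp [onsState]
  | succ t ih =>
    rw [onsState_succ]
    positivity

lemma onsState_snd_le {eps : ℝ → ℝ} {k : ℝ} {p : ℕ → ℝ}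
    (heps : ∀ q ∈ Set.Icc (0 : ℝ) 1, eps q ∈ Set.Icc (0 : ℝ) 1) (hk : 0 < k)
    (hp : ∀ t, p t ∈ Set.Icc (0 : ℝ) 1) (t : ℕ) :
    (onsState eps k p t).2 ≤ 1 + 4 * t := by
  induction t with
  | zero => simp [onsState]
  | succ t ih =>
    have hz := abs_le.1
      (abs_onsGrad_le_two heps hk (hp (t + 1)) (abs_onsState_fst_le eps k p t))
    rw [onsState_succ]
    push_cast
    nlinarith

lemma regret_le_potential {eps : ℝ → ℝ} {k : ℝ} {p : ℕ → ℝ}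
    (heps : ∀ q ∈ Set.Icc (0 : ℝ) 1, eps q ∈ Set.Icc (0 : ℝ) 1) (hk : 0 < k)
    (hp : ∀ t, p t ∈ Set.Icc (0 : ℝ) 1) {y : ℝ} (hy : |y| ≤ 1 / 2) (T : ℕ) :
    regret eps k p (onsEta eps k p) y T ≤
      y ^ 2 / 8 - (onsState eps k p T).2 * (y - (onsState eps k p T).1) ^ 2 / 8
        + 2 * Real.log (onsState eps k p T).2 := by
  induction T with
  | zero => simp [regret, onsState]
  | succ T ih =>
    have hloss := onsLoss_sub_le heps hk hp (T + 1) (abs_onsState_fst_le eps k p T) hy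
    have hstep := newton_step_le (x := (onsState eps k p T).1)
      (z := onsGrad eps k (p (T + 1)) (onsState eps k p T).1) (onsState_snd_pos eps k p T) hy
    have hsucc : regret eps k p (onsEta eps k p) y (T + 1)
        = regret eps k p (onsEta eps k p) y T
          + (onsLoss eps k p (T + 1) (onsState eps k p T).1 - onsLoss eps k p (T + 1) y) :=
      Finset.sum_Icc_succ_top (by omega) _
    rw [hsucc, onsState_succ]
    linarith

/-- For an arbitrary sequence `p̂₁, p̂₂, … ∈ [0,1]`, measurable
`ε : [0,1] → [0,1]`, and `k > 0`, the Online Newton Step iterates `(η_t)` satisfy, for every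
`T ≥ 1` and every benchmark `η̃ ∈ [−1/2, 1/2]`, the regret bound
`R_T(η̃) ≤ 2·ln(1 + 4T) + 1/2`. -/
theorem stmt7 (p : ℕ → ℝ) (hp : ∀ t, p t ∈ Set.Icc (0 : ℝ) 1)
    (eps : ℝ → ℝ) (hepsMeas : Measurable eps)
    (heps01 : ∀ q ∈ Set.Icc (0 : ℝ) 1, eps q ∈ Set.Icc (0 : ℝ) 1)
    (k : ℝ) (hk : 0 < k)
    (T : ℕ) (hT : 1 ≤ T)
    (ηb : ℝ) (hηb : ηb ∈ Set.Icc (-(1 / 2) : ℝ) (1 / 2)) :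
    regret eps k p (onsEta eps k p) ηb T ≤ 2 * Real.log (1 + 4 * T) + 1 / 2 := by
  have hy : |ηb| ≤ 1 / 2 := abs_le.2 hηb
  have hpot := regret_le_potential heps01 hk hp hy T
  have hpos := onsState_snd_pos eps k p T
  have hlog := Real.log_le_log hpos (onsState_snd_le heps01 hk hp T)
  have hnonneg : 0 ≤ (onsState eps k p T).2 * (ηb - (onsState eps k p T).1) ^ 2 := by positivity
  have hsq : ηb ^ 2 ≤ (1 / 2) ^ 2 := sq_le_sq' hηb.1 hηb.2
  linarith

end
end
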